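/- Let φ be an Orlicz N-function with right derivative p, and let f ∈ Λ_{φ,w}. If there exists k > 0 such that ρ_{φ*,w}(p(k|f|)) = 1, then ‖f‖⁰ = ∫_I f*(t) p(k f*(t)) w(t) dt = (1/k)(1 + ρ_{φ,w}(kf)). -/

import Mathlib

open MeasureTheory Set Filter Topology ENNReal

noncomputable section

namespace OL

/-- The interval `I = [0, γ)` inside `ℝ`, for `γ : ℝ≥0∞`. -/
def II (γ : ℝ≥0∞) : Set ℝ := {t : ℝ | 0 ≤ t ∧ (ENNReal.ofReal t) < γ}

/-- Distribution function of `f` on `I = [0, γ)`. -/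
def df (γ : ℝ≥0∞) (f : ℝ → ℝ) (l : ℝ) : ℝ≥0∞ := volume {s | s ∈ II γ ∧ l < |f s|}

/-- Decreasing rearrangement of `f` on `I = [0, γ)`. -/
def rear (γ : ℝ≥0∞) (f : ℝ → ℝ) (t : ℝ) : ℝ :=
  sInf {l : ℝ | 0 < l ∧ df γ f l ≤ ENNReal.ofReal t}

/-- The modular `ρ_{φ,w}(f) = ∫_I φ(f^*) w`. -/
def rho (γ : ℝ≥0∞) (φ w f : ℝ → ℝ) : ℝ≥0∞ :=
  ∫⁻ t in II γ, ENNReal.ofReal (φ (rear γ f t) * w t)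

/-- Membership in the Orlicz–Lorentz space `Λ_{φ,w}`. -/
def MemL (γ : ℝ≥0∞) (φ w f : ℝ → ℝ) : Prop :=
  Measurable f ∧ ∃ l : ℝ, 0 < l ∧ rho γ φ w (fun t => l * f t) < ⊤

/-- Membership in the order-continuous part `(Λ_{φ,w})_a`. -/
def MemLa (γ : ℝ≥0∞) (φ w f : ℝ → ℝ) : Prop :=
  Measurable f ∧ ∀ l : ℝ, 0 < l → rho γ φ w (fun t => l * f t) < ⊤

/-- The Luxemburg norm on `Λ_{φ,w}`. -/
def lux (γ : ℝ≥0∞) (φ w f : ℝ → ℝ) : ℝ :=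
  sInf {ε : ℝ | 0 < ε ∧ rho γ φ w (fun t => f t / ε) ≤ 1}

/-- The complementary Orlicz function `φ_*(v) = sup{uv - φ(u) : u ≥ 0}`. -/
def conj (φ : ℝ → ℝ) (v : ℝ) : ℝ := sSup {x : ℝ | ∃ u : ℝ, 0 ≤ u ∧ x = u * v - φ u}

/-- The Orlicz norm on `Λ_{φ,w}` (with values in `ℝ≥0∞`):
`‖f‖⁰ = sup{∫_I f^* g^* w : ρ_{φ_*,w}(g) ≤ 1}`. -/
def orl (γ : ℝ≥0∞) (φ w f : ℝ → ℝ) : ℝ≥0∞ :=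
  ⨆ g ∈ {g : ℝ → ℝ | Measurable g ∧ rho γ (conj φ) w g ≤ 1},
    ∫⁻ t in II γ, ENNReal.ofReal (rear γ f t * rear γ g t * w t)

/-- `θ(f) = inf{λ > 0 : ρ_{φ,w}(f/λ) < ∞}`. -/
def theta (γ : ℝ≥0∞) (φ w f : ℝ → ℝ) : ℝ :=
  sInf {l : ℝ | 0 < l ∧ rho γ φ w (fun t => f t / l) < ⊤}

/-- Orlicz function. -/
def IsOrlicz (φ : ℝ → ℝ) : Prop :=
  ConvexOn ℝ (Ici 0) φ ∧ φ 0 = 0 ∧ ∀ t : ℝ, 0 < t → 0 < φ t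

/-- Orlicz `N`-function. -/
def IsN (φ : ℝ → ℝ) : Prop :=
  IsOrlicz φ ∧ Tendsto (fun t => φ t / t) (𝓝[>] (0:ℝ)) (𝓝 0) ∧
    Tendsto (fun t => φ t / t) atTop atTop

/-- `p` is the right derivative of `φ` on `[0,∞)`. -/
def IsRightDeriv (φ p : ℝ → ℝ) : Prop :=
  ∀ u : ℝ, 0 ≤ u → HasDerivWithinAt φ (p u) (Ici u) u

/-- An admissible (decreasing, positive, locally integrable) weight on `[0, γ)`,
with `W(∞) = ∞` when `γ = ∞`. -/
def IsWeight (γ : ℝ≥0∞) (w : ℝ → ℝ) : Prop :=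
  Measurable w ∧ (∀ t ∈ II γ, 0 < w t) ∧
  (∀ s ∈ II γ, ∀ t ∈ II γ, s ≤ t → w t ≤ w s) ∧
  (∀ t ∈ II γ, IntegrableOn w (Icc 0 t) volume) ∧
  (γ = ⊤ → (∫⁻ t in II γ, ENNReal.ofReal (w t)) = ⊤)

/-- `k^*(f)`. -/
def kstar (γ : ℝ≥0∞) (φ w p f : ℝ → ℝ) : ℝ :=
  sInf {k : ℝ | 0 < k ∧ 1 ≤ rho γ (conj φ) w (fun t => p (k * |f t|))}

/-- `k^{**}(f)`. -/
def kstarstar (γ : ℝ≥0∞) (φ w p f : ℝ → ℝ) : ℝ :=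
  sSup {k : ℝ | 0 < k ∧ rho γ (conj φ) w (fun t => p (k * |f t|)) ≤ 1}

/-- Linearity of a functional on the subspace `Λ_{φ,w}`. -/
def IsLin (γ : ℝ≥0∞) (φ w : ℝ → ℝ) (S : (ℝ → ℝ) → ℝ) : Prop :=
  (∀ f g : ℝ → ℝ, MemL γ φ w f → MemL γ φ w g → S (f + g) = S f + S g) ∧
  (∀ (c : ℝ) (f : ℝ → ℝ), MemL γ φ w f → S (c • f) = c * S f)

/-- Boundedness with respect to the Luxemburg norm. -/
def BddLux (γ : ℝ≥0∞) (φ w : ℝ → ℝ) (S : (ℝ → ℝ) → ℝ) : Prop :=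
  ∃ C : ℝ, ∀ f : ℝ → ℝ, MemL γ φ w f → |S f| ≤ C * lux γ φ w f

/-- Boundedness with respect to the Orlicz norm. -/
def BddOrl (γ : ℝ≥0∞) (φ w : ℝ → ℝ) (S : (ℝ → ℝ) → ℝ) : Prop :=
  ∃ C : ℝ, 0 ≤ C ∧ ∀ f : ℝ → ℝ, MemL γ φ w f →
    ENNReal.ofReal |S f| ≤ ENNReal.ofReal C * orl γ φ w f

/-- A singular functional: bounded, linear, vanishing on the order-continuous part. -/
def IsSingular (γ : ℝ≥0∞) (φ w : ℝ → ℝ) (S : (ℝ → ℝ) → ℝ) : Prop :=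
  IsLin γ φ w S ∧ BddLux γ φ w S ∧ ∀ f : ℝ → ℝ, MemLa γ φ w f → S f = 0

/-- Operator norm with respect to the Luxemburg norm. -/
def opLux (γ : ℝ≥0∞) (φ w : ℝ → ℝ) (S : (ℝ → ℝ) → ℝ) : ℝ :=
  sSup {r : ℝ | ∃ f : ℝ → ℝ, MemL γ φ w f ∧ lux γ φ w f ≤ 1 ∧ r = S f}

/-- Operator norm with respect to the Orlicz norm. -/
def opOrl (γ : ℝ≥0∞) (φ w : ℝ → ℝ) (S : (ℝ → ℝ) → ℝ) : ℝ :=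
  sSup {r : ℝ | ∃ f : ℝ → ℝ, MemL γ φ w f ∧ orl γ φ w f ≤ 1 ∧ r = S f}

/-- `v ≺ w` : `∫₀ᵗ v^* ≤ ∫₀ᵗ w` for all `t ∈ I`, with `v` nonnegative and measurable. -/
def Prec (γ : ℝ≥0∞) (w v : ℝ → ℝ) : Prop :=
  Measurable v ∧ (∀ t : ℝ, 0 ≤ v t) ∧
  ∀ t ∈ II γ, (∫⁻ s in Icc (0:ℝ) t, ENNReal.ofReal (rear γ v s)) ≤
    ∫⁻ s in Icc (0:ℝ) t, ENNReal.ofReal (w s)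

/-- The modular `P_{ψ,w}(h) = inf{∫_I ψ(|h|/v) v : v ≥ 0, v ≺ w}`. -/
def P (γ : ℝ≥0∞) (ψ w h : ℝ → ℝ) : ℝ≥0∞ :=
  ⨅ v ∈ {v : ℝ → ℝ | Prec γ w v}, ∫⁻ t in II γ, ENNReal.ofReal (ψ (|h t| / v t) * v t)

/-- Luxemburg norm of the space `M_{ψ,w}` (real-valued). -/
def Mlux (γ : ℝ≥0∞) (ψ w h : ℝ → ℝ) : ℝ :=
  sInf {ε : ℝ | 0 < ε ∧ P γ ψ w (fun t => h t / ε) ≤ 1}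

/-- Luxemburg norm of the space `M_{ψ,w}` (`ℝ≥0∞`-valued; `∞` when `h ∉ M_{ψ,w}`). -/
def MluxE (γ : ℝ≥0∞) (ψ w h : ℝ → ℝ) : ℝ≥0∞ :=
  sInf {e : ℝ≥0∞ | ∃ ε : ℝ, 0 < ε ∧ e = ENNReal.ofReal ε ∧ P γ ψ w (fun t => h t / ε) ≤ 1}

/-- Orlicz norm of the space `M_{ψ,w}`: `inf_{k>0} (1/k)(1 + P_{ψ,w}(kh))`. -/
def Morl (γ : ℝ≥0∞) (ψ w h : ℝ → ℝ) : ℝ≥0∞ :=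
  ⨅ k ∈ Ioi (0:ℝ), (ENNReal.ofReal k)⁻¹ * (1 + P γ ψ w (fun t => k * h t))

/-- The appropriate `Δ₂` condition: `Δ₂` if `γ = ∞`, `Δ₂^∞` if `γ < ∞`. -/
def appDelta2 (γ : ℝ≥0∞) (φ : ℝ → ℝ) : Prop :=
  (γ = ⊤ → ∃ K : ℝ, 0 < K ∧ ∀ u : ℝ, 0 ≤ u → φ (2 * u) ≤ K * φ u) ∧
  (γ ≠ ⊤ → ∃ K u₀ : ℝ, 0 < K ∧ 0 ≤ u₀ ∧ ∀ u : ℝ, u₀ ≤ u → φ (2 * u) ≤ K * φ u)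

/-- finite distribution function at positive levels -/
def FinD (γ : ℝ≥0∞) (f : ℝ → ℝ) : Prop := ∀ l : ℝ, 0 < l → df γ f l < ⊤

theorem df_anti (γ : ℝ≥0∞) (f : ℝ → ℝ) {a b : ℝ} (h : a ≤ b) : df γ f b ≤ df γ f a :=
  measure_mono fun _ hs => ⟨hs.1, h.trans_lt hs.2⟩

theorem II_meas (γ : ℝ≥0∞) : MeasurableSet (II γ) := by
  unfold II
  exact (measurableSet_Ici (a := (0:ℝ))).inter
    (measurableSet_lt ENNReal.measurable_ofReal measurable_const)

theorem bddB (γ : ℝ≥0∞) (f : ℝ → ℝ) (t : ℝ) :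
    BddBelow {l : ℝ | 0 < l ∧ df γ f l ≤ ENNReal.ofReal t} := ⟨0, fun _ h => h.1.le⟩

theorem rear_nonneg (γ : ℝ≥0∞) (f : ℝ → ℝ) (t : ℝ) : 0 ≤ rear γ f t :=
  Real.sInf_nonneg fun _ h => h.1.le

theorem aem_of_anti (γ : ℝ≥0∞) (f : ℝ → ℝ) : AEMeasurable (rear γ f) volume := by
  set S : Set ℝ := {t | ({l : ℝ | 0 < l ∧ df γ f l ≤ ENNReal.ofReal t}).Nonempty} with hS
  have hup : ∀ s ∈ S, ∀ t, s ≤ t → t ∈ S := by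
    rintro s ⟨l, hl, hl'⟩ t hst
    exact ⟨l, hl, hl'.trans (ENNReal.ofReal_le_ofReal hst)⟩
  have hoc : S.OrdConnected := ⟨fun x hx y _ z hz => hup x hx z hz.1⟩
  have hm : MeasurableSet S := hoc.measurableSet
  have hanti : AntitoneOn (rear γ f) S := by
    intro s hs t ht hst
    exact csInf_le_csInf (bddB γ f t) hs
      fun l hl => ⟨hl.1, hl.2.trans (ENNReal.ofReal_le_ofReal hst)⟩
  have h1 : AEMeasurable (rear γ f) (volume.restrict S) :=
    aemeasurable_restrict_of_antitoneOn hm hanti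
  have h2 : AEMeasurable (rear γ f) (volume.restrict Sᶜ) := by
    refine (aemeasurable_const (b := (0:ℝ))).congr ?_
    filter_upwards [ae_restrict_mem hm.compl] with t ht
    have : {l : ℝ | 0 < l ∧ df γ f l ≤ ENNReal.ofReal t} = ∅ := by
      rw [← Set.not_nonempty_iff_eq_empty]; exact ht
    simp [rear, this]
  have := (aemeasurable_union_iff (s := S) (t := Sᶜ) (μ := volume) (f := rear γ f)).2 ⟨h1, h2⟩
  simpa using this

theorem df_meas {γ : ℝ≥0∞} {f : ℝ → ℝ} (hf : Measurable f) (l : ℝ) :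
    MeasurableSet {s | s ∈ II γ ∧ l < |f s|} :=
  (II_meas γ).inter (measurableSet_lt measurable_const hf.abs)

/-- the defining set is nonempty at positive times -/
theorem ne_of_fin {γ : ℝ≥0∞} {f : ℝ → ℝ} (hf : Measurable f) {l₀ : ℝ}
    (h : df γ f l₀ < ⊤) {t : ℝ} (ht : 0 < t) :
    ({l : ℝ | 0 < l ∧ df γ f l ≤ ENNReal.ofReal t}).Nonempty := by
  have hlim : Tendsto (fun n : ℕ => df γ f (l₀ + n)) atTop
      (𝓝 (volume (⋂ n : ℕ, {s | s ∈ II γ ∧ l₀ + n < |f s|}))) := by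
    apply tendsto_measure_iInter_atTop
    · intro n; exact (df_meas hf _).nullMeasurableSet
    · intro m n hmn s hs
      refine ⟨hs.1, lt_of_le_of_lt ?_ hs.2⟩
      have : (m:ℝ) ≤ n := by exact_mod_cast hmn
      linarith
    · refine ⟨0, ?_⟩
      simpa [df] using h.ne
  have hempty : (⋂ n : ℕ, {s | s ∈ II γ ∧ l₀ + n < |f s|}) = ∅ := by
    ext s
    simp only [mem_iInter, mem_empty_iff_false, iff_false, not_forall]
    obtain ⟨n, hn⟩ := exists_nat_gt (|f s| - l₀)
    exact ⟨n, fun hs => by have := hs.2; linarith⟩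
  rw [hempty, measure_empty] at hlim
  have h0 : (0:ℝ≥0∞) < ENNReal.ofReal t := ENNReal.ofReal_pos.2 ht
  obtain ⟨n, hn⟩ := ((hlim.eventually (gt_mem_nhds h0))).exists
  refine ⟨max 1 (l₀ + n), by positivity, (df_anti γ f (le_max_right _ _)).trans hn.le⟩

theorem rear_anti {γ : ℝ≥0∞} {f : ℝ → ℝ} (hf : Measurable f) (h : FinD γ f) :
    AntitoneOn (rear γ f) (Ioi 0) := by
  intro s hs t ht hst
  exact csInf_le_csInf (bddB γ f t) (ne_of_fin hf (h 1 one_pos) hs)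
      fun l hl => ⟨hl.1, hl.2.trans (ENNReal.ofReal_le_ofReal hst)⟩

/-- if `rear f t < l` then `df l ≤ t`. -/
theorem df_le_of_rear_lt {γ : ℝ≥0∞} {f : ℝ → ℝ} (hf : Measurable f) (h : FinD γ f)
    {t l : ℝ} (ht : 0 < t) (hl : rear γ f t < l) : df γ f l ≤ ENNReal.ofReal t := by
  obtain ⟨m, hm, hml⟩ := exists_lt_of_csInf_lt (ne_of_fin hf (h 1 one_pos) ht) hl
  exact (df_anti γ f hml.le).trans hm.2

/-- right continuity: `df (rear f t) ≤ t`. -/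
theorem df_rear_le {γ : ℝ≥0∞} {f : ℝ → ℝ} (hf : Measurable f) (h : FinD γ f)
    {t : ℝ} (ht : 0 < t) : df γ f (rear γ f t) ≤ ENNReal.ofReal t := by
  set r := rear γ f t with hr
  have hU : {s | s ∈ II γ ∧ r < |f s|} = ⋃ n : ℕ, {s | s ∈ II γ ∧ r + 1 / ((n:ℝ) + 1) < |f s|} := by
    ext s
    simp only [mem_setOf_eq, mem_iUnion]
    constructor
    · rintro ⟨h1, h2⟩
      obtain ⟨n, hn⟩ := exists_nat_one_div_lt (sub_pos.2 h2)
      exact ⟨n, h1, by linarith⟩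
    · rintro ⟨n, h1, h2⟩
      have : (0:ℝ) < 1 / ((n:ℝ) + 1) := by positivity
      exact ⟨h1, by linarith⟩
  have hmono : Monotone fun n : ℕ => {s | s ∈ II γ ∧ r + 1 / ((n:ℝ) + 1) < |f s|} := by
    intro m n hmn s hs
    refine ⟨hs.1, lt_of_le_of_lt ?_ hs.2⟩
    have : 1 / ((n:ℝ) + 1) ≤ 1 / ((m:ℝ) + 1) := one_div_le_one_div_of_le (by positivity)
      (by have : (m:ℝ) ≤ n := by exact_mod_cast hmn
          linarith)
    linarith
  rw [df, hU, hmono.measure_iUnion]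
  refine iSup_le fun n => ?_
  have : (0:ℝ) < 1 / ((n:ℝ) + 1) := by positivity
  exact df_le_of_rear_lt hf h ht (by linarith)

/-- `m{|f| ≥ f*(t)} ≥ t` when `f*(t) > 0`. -/
theorem le_meas_ge_rear {γ : ℝ≥0∞} {f : ℝ → ℝ} (hf : Measurable f) (h : FinD γ f)
    {t : ℝ} (hr : 0 < rear γ f t) :
    ENNReal.ofReal t ≤ volume {s | s ∈ II γ ∧ rear γ f t ≤ |f s|} := by
  set r := rear γ f t with hrdef
  have hU : {s | s ∈ II γ ∧ r ≤ |f s|} =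
      ⋂ n : ℕ, {s | s ∈ II γ ∧ r - r / ((n:ℝ) + 2) < |f s|} := by
    ext s
    simp only [mem_setOf_eq, mem_iInter]
    constructor
    · rintro ⟨h1, h2⟩ n
      have : (0:ℝ) < r / ((n:ℝ) + 2) := by positivity
      exact ⟨h1, by linarith⟩
    · intro hn
      refine ⟨(hn 0).1, ?_⟩
      by_contra hlt
      push Not at hlt
      obtain ⟨n, hn'⟩ := exists_nat_gt (r / (r - |f s|))
      have h2 := (hn n).2
      have hpos : 0 < r - |f s| := by linarith
      rw [div_lt_iff₀ hpos] at hn'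
      have : r / ((n:ℝ) + 2) < r - |f s| := by
        rw [div_lt_iff₀ (by positivity)]
        nlinarith
      linarith
  have hlim : Tendsto (fun n : ℕ => df γ f (r - r / ((n:ℝ) + 2))) atTop
      (𝓝 (volume (⋂ n : ℕ, {s | s ∈ II γ ∧ r - r / ((n:ℝ) + 2) < |f s|}))) := by
    apply tendsto_measure_iInter_atTop
    · intro n; exact (df_meas hf _).nullMeasurableSet
    · intro m n hmn s hs
      refine ⟨hs.1, lt_of_le_of_lt ?_ hs.2⟩
      have : r / ((n:ℝ) + 2) ≤ r / ((m:ℝ) + 2) := by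
        have : (m:ℝ) ≤ n := by exact_mod_cast hmn
        gcongr
      linarith
    · refine ⟨0, ?_⟩
      have := (h (r - r / ((0:ℕ) + 2)) (by norm_num; linarith)).ne
      exact this
  rw [hU]
  refine ge_of_tendsto' hlim fun n => ?_
  have h2 : r / ((n:ℝ) + 2) < r := by
    rw [div_lt_iff₀ (by positivity)]
    have : (0:ℝ) ≤ n := by positivity
    nlinarith
  have h3 : (0:ℝ) < r / ((n:ℝ) + 2) := by positivity
  by_contra hcon
  push Not at hcon
  have : r ≤ r - r / ((n:ℝ) + 2) := csInf_le (bddB γ f t) ⟨by linarith, hcon.le⟩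
  linarith

theorem rear_smul (γ : ℝ≥0∞) (f : ℝ → ℝ) {k : ℝ} (hk : 0 < k) (t : ℝ) :
    rear γ (fun s => k * f s) t = k * rear γ f t := by
  have hdf : ∀ l, df γ (fun s => k * f s) (k * l) = df γ f l := by
    intro l
    simp only [df, abs_mul, abs_of_pos hk]
    congr 1
    ext s
    simp [hk]
  have : {l : ℝ | 0 < l ∧ df γ (fun s => k * f s) l ≤ ENNReal.ofReal t} =
      (fun l => k * l) '' {l : ℝ | 0 < l ∧ df γ f l ≤ ENNReal.ofReal t} := by
    ext l
    simp only [mem_setOf_eq, mem_image]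
    constructor
    · rintro ⟨h1, h2⟩
      refine ⟨l / k, ⟨by positivity, ?_⟩, by field_simp⟩
      rw [← hdf]
      convert h2 using 2
      field_simp
    · rintro ⟨m, ⟨h1, h2⟩, rfl⟩
      exact ⟨by positivity, by rw [hdf]; exact h2⟩
  unfold rear
  rw [this]
  have := Real.sInf_smul_of_nonneg hk.le {l : ℝ | 0 < l ∧ df γ f l ≤ ENNReal.ofReal t}
  simpa [← Set.image_smul] using this

section conv
variable {φ p : ℝ → ℝ}

theorem subgrad (hφ : IsN φ) (hp : IsRightDeriv φ p) {u v : ℝ} (hu : 0 ≤ u) (hv : 0 ≤ v) :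
    φ u + p u * (v - u) ≤ φ v := by
  have hc := hφ.1.1
  have hs : Tendsto (slope φ u) (𝓝[>] u) (𝓝 (p u)) := by
    have := hasDerivWithinAt_iff_tendsto_slope.1 (hp u hu)
    simpa using this
  rcases lt_trichotomy u v with h | h | h
  · have : p u ≤ (φ v - φ u) / (v - u) := by
      refine le_of_tendsto hs ?_
      filter_upwards [Ioo_mem_nhdsGT h] with x hx
      rw [slope_def_field]
      exact hc.secant_mono hu (hu.trans hx.1.le) hv hx.1.ne' h.ne' hx.2.le
    rw [le_div_iff₀ (by linarith)] at this
    linarith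
  · subst h; simp
  · have : (φ u - φ v) / (u - v) ≤ p u := by
      refine ge_of_tendsto hs ?_
      filter_upwards [self_mem_nhdsWithin] with x hx
      rw [slope_def_field]
      exact hc.slope_mono_adjacent hv (hu.trans (le_of_lt hx)) h hx
    rw [div_le_iff₀ (by linarith)] at this
    linarith

theorem p_mono (hφ : IsN φ) (hp : IsRightDeriv φ p) {u v : ℝ} (hu : 0 ≤ u) (h : u ≤ v) :
    p u ≤ p v := by
  rcases h.eq_or_lt with rfl | h'
  · rfl
  have h1 := subgrad hφ hp hu (hu.trans h)
  have h2 := subgrad hφ hp (hu.trans h) hu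
  nlinarith

theorem p_pos (hφ : IsN φ) (hp : IsRightDeriv φ p) {u : ℝ} (hu : 0 < u) : 0 < p u := by
  have h1 := subgrad hφ hp hu.le le_rfl
  have h2 := hφ.1.2.2 u hu
  have h3 := hφ.1.2.1
  have : 0 < p u * u := by linarith
  exact pos_of_mul_pos_left this hu.le

theorem p_zero (hφ : IsN φ) (hp : IsRightDeriv φ p) : p 0 = 0 := by
  have hs : Tendsto (slope φ 0) (𝓝[>] 0) (𝓝 (p 0)) := by
    have := hasDerivWithinAt_iff_tendsto_slope.1 (hp 0 le_rfl)
    simpa using this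
  refine tendsto_nhds_unique hs (hφ.2.1.congr fun x => ?_)
  simp [slope_def_field, hφ.1.2.1]

theorem p_nonneg (hφ : IsN φ) (hp : IsRightDeriv φ p) {u : ℝ} (hu : 0 ≤ u) : 0 ≤ p u :=
  (p_zero hφ hp).symm.le.trans (p_mono hφ hp le_rfl hu)

theorem phi_nonneg (hφ : IsN φ) {u : ℝ} (hu : 0 ≤ u) : 0 ≤ φ u := by
  rcases hu.eq_or_lt with rfl | h
  · exact hφ.1.2.1.symm.le
  · exact (hφ.1.2.2 u h).le

theorem phi_mono (hφ : IsN φ) (hp : IsRightDeriv φ p) {u v : ℝ} (hu : 0 ≤ u) (h : u ≤ v) :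
    φ u ≤ φ v := by
  have h1 := subgrad hφ hp hu (hu.trans h)
  have h2 := p_nonneg hφ hp hu
  nlinarith [mul_nonneg h2 (sub_nonneg.2 h)]

theorem conj_bdd (hφ : IsN φ) (v : ℝ) :
    BddAbove {x : ℝ | ∃ u : ℝ, 0 ≤ u ∧ x = u * v - φ u} := by
  obtain ⟨U, hU⟩ := (hφ.2.2.eventually_ge_atTop v).exists_forall_of_atTop
  refine ⟨max U 0 * |v|, ?_⟩
  rintro x ⟨u, hu, rfl⟩
  have h0 := phi_nonneg hφ hu
  have hpos : 0 ≤ max U 0 * |v| := by positivity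
  rcases le_or_gt u (max U 0) with h | h
  · have : u * v ≤ max U 0 * |v| :=
      mul_le_mul_of_nonneg' h (le_abs_self v) |> fun hh => by
        nlinarith [le_abs_self v, abs_nonneg v, mul_le_mul_of_nonneg_left (le_abs_self v) hu,
          mul_le_mul_of_nonneg_right h (abs_nonneg v)]
    linarith
  · have hu' : 0 < u := (le_max_right _ _).trans_lt h
    have := hU u ((le_max_left _ _).trans h.le)
    rw [le_div_iff₀ hu'] at this
    linarith

theorem young (hφ : IsN φ) {u : ℝ} (hu : 0 ≤ u) (v : ℝ) : u * v ≤ φ u + conj φ v := by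
  have : u * v - φ u ≤ conj φ v := le_csSup (conj_bdd hφ v) ⟨u, hu, rfl⟩
  linarith

theorem young_eq (hφ : IsN φ) (hp : IsRightDeriv φ p) {u : ℝ} (hu : 0 ≤ u) :
    u * p u = φ u + conj φ (p u) := by
  apply le_antisymm (young hφ hu _)
  have : conj φ (p u) ≤ u * p u - φ u := by
    refine csSup_le ⟨_, 0, le_rfl, rfl⟩ ?_
    rintro x ⟨v, hv, rfl⟩
    have := subgrad hφ hp hu hv
    linarith
  linarith

theorem conj_nonneg (hφ : IsN φ) (v : ℝ) : 0 ≤ conj φ v := by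
  have := young hφ le_rfl v
  simpa [hφ.1.2.1] using this

theorem conj_mono (hφ : IsN φ) {a b : ℝ} (h : a ≤ b) : conj φ a ≤ conj φ b := by
  refine csSup_le ⟨_, 0, le_rfl, rfl⟩ ?_
  rintro x ⟨v, hv, rfl⟩
  have := young hφ hv b
  have := mul_le_mul_of_nonneg_left h hv
  linarith

theorem conj_zero (hφ : IsN φ) : conj φ 0 = 0 := by
  apply le_antisymm _ (conj_nonneg hφ 0)
  refine csSup_le ⟨_, 0, le_rfl, rfl⟩ ?_
  rintro x ⟨v, hv, rfl⟩
  have := phi_nonneg hφ hv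
  linarith

theorem conj_pos (hφ : IsN φ) {v : ℝ} (hv : 0 < v) : 0 < conj φ v := by
  obtain ⟨u, hu, hu0⟩ := ((hφ.2.1.eventually (gt_mem_nhds hv)).and self_mem_nhdsWithin).exists
  have hu0 : 0 < u := hu0
  rw [div_lt_iff₀ hu0] at hu
  have := young hφ hu0.le v
  linarith

theorem meas_phi_comp (hφ : IsN φ) (hp : IsRightDeriv φ p) {g : ℝ → ℝ} (hg : ∀ t, 0 ≤ g t)
    {μ : Measure ℝ} (hgm : AEMeasurable g μ) : AEMeasurable (fun t => φ (g t)) μ := by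
  have hm : Monotone fun x => φ (max x 0) := fun a b hab =>
    phi_mono hφ hp (le_max_right _ _) (max_le_max_right 0 hab)
  have := hm.measurable.comp_aemeasurable hgm
  refine this.congr (Eventually.of_forall fun t => ?_)
  simp [hg t]

theorem meas_p_comp (hφ : IsN φ) (hp : IsRightDeriv φ p) {g : ℝ → ℝ} (hg : Measurable g) :
    Measurable (fun t => p |g t|) := by
  have hm : Monotone fun x => p (max x 0) := fun a b hab =>
    p_mono hφ hp (le_max_right _ _) (max_le_max_right 0 hab)
  have := hm.measurable.comp hg.abs
  convert this using 2 with t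
  simp

/-- rearrangement of `p(|F|)` -/
theorem rear_p (hφ : IsN φ) (hp : IsRightDeriv φ p) {γ : ℝ≥0∞} {F : ℝ → ℝ} (hF : Measurable F)
    (hFin : FinD γ F) (hGin : FinD γ (fun t => p |F t|)) :
    ∀ᵐ t ∂(volume.restrict (II γ)), rear γ (fun t => p |F t|) t = p (rear γ F t) := by
  set G := fun t => p |F t| with hG
  have hGm : Measurable G := meas_p_comp hφ hp hF
  have habs : ∀ s, |G s| = p |F s| := fun s => abs_of_nonneg (p_nonneg hφ hp (abs_nonneg _))
  have up : ∀ t, 0 < t → rear γ G t ≤ p (rear γ F t) := by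
    intro t ht
    have key : ∀ l, 0 < l → p (rear γ F t) ≤ l → rear γ G t ≤ l := by
      intro l hl hpl
      refine csInf_le (bddB _ _ _) ⟨hl, le_trans (measure_mono ?_) (df_rear_le hF hFin ht)⟩
      rintro s ⟨h1, h2⟩
      refine ⟨h1, ?_⟩
      rw [habs] at h2
      by_contra hcon
      push Not at hcon
      have := p_mono hφ hp (abs_nonneg (F s)) hcon
      linarith
    refine le_of_forall_pos_le_add fun ε hε => ?_
    have := p_nonneg hφ hp (rear_nonneg γ F t)
    exact key _ (by linarith) (by linarith)
  have low : ∀ s t, 0 < s → s < t → p (rear γ F t) ≤ rear γ G s := by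
    intro s t hs hst
    rcases (rear_nonneg γ F t).eq_or_lt with h0 | h0
    · rw [← h0, p_zero hφ hp]; exact rear_nonneg _ _ _
    refine le_csInf (ne_of_fin hGm (hGin 1 one_pos) hs) ?_
    rintro l ⟨hl, hl'⟩
    by_contra hcon
    push Not at hcon
    have h1 := le_meas_ge_rear hF hFin h0
    have h2 : volume {x | x ∈ II γ ∧ rear γ F t ≤ |F x|} ≤ df γ G l := by
      refine measure_mono ?_
      rintro x ⟨hx1, hx2⟩
      refine ⟨hx1, ?_⟩
      rw [habs]
      exact hcon.trans_le (p_mono hφ hp h0.le hx2)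
    have h3 := (h1.trans h2).trans hl'
    have h4 : ENNReal.ofReal s < ENNReal.ofReal t :=
      (ENNReal.ofReal_lt_ofReal_iff (hs.trans hst)).2 hst
    exact absurd h3 (not_le.2 h4)
  have hanti := rear_anti hGm hGin
  have hcount := hanti.countable_not_continuousWithinAt
  have hae : ∀ᵐ t ∂(volume.restrict (II γ)), t ∉ {x ∈ Ioi (0:ℝ) | ¬ContinuousWithinAt (rear γ G) (Ioi 0) x} :=
    ae_restrict_of_ae (compl_mem_ae_iff.2 (hcount.measure_zero volume))
  have hae0 : ∀ᵐ t ∂(volume.restrict (II γ)), t ∉ ({0} : Set ℝ) :=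
    ae_restrict_of_ae (compl_mem_ae_iff.2 (by simp))
  filter_upwards [hae, hae0, ae_restrict_mem (II_meas γ)] with t h1 h2 h3
  have ht : 0 < t := lt_of_le_of_ne h3.1 (fun h => h2 h.symm)
  refine le_antisymm (up t ht) ?_
  have hc : ContinuousWithinAt (rear γ G) (Ioi 0) t := by
    by_contra hcc; exact h1 ⟨ht, hcc⟩
  have hc' : Tendsto (rear γ G) (𝓝[<] t) (𝓝 (rear γ G t)) :=
    (hc.continuousAt (Ioi_mem_nhds ht)).tendsto.mono_left nhdsWithin_le_nhds
  refine ge_of_tendsto hc' ?_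
  filter_upwards [Ioo_mem_nhdsLT ht] with s hs
  exact low s t hs.1 hs.2

/-- finite modular forces finite distribution -/
theorem fin_of_rho (hφ : IsN φ) {γ : ℝ≥0∞} {w : ℝ → ℝ} (hw : IsWeight γ w) {G : ℝ → ℝ}
    (hG : Measurable G) (h : rho γ (conj φ) w G = 1) : FinD γ G := by
  intro l hl
  by_contra hcon
  have htop : df γ G l = ⊤ := by simpa using hcon
  by_cases hex : ∃ l₀, df γ G l₀ < ⊤
  · obtain ⟨l₀, hl₀⟩ := hex
    have hγ : γ = ⊤ := by
      by_contra hne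
      have h1 : df γ G l ≤ volume (Icc 0 γ.toReal) := by
        refine measure_mono ?_
        rintro s ⟨⟨h0, h1⟩, -⟩
        refine ⟨h0, ?_⟩
        exact ((ENNReal.ofReal_lt_iff_lt_toReal h0 hne).1 h1).le
      rw [htop] at h1
      simp at h1
    have hge : ∀ t, 0 < t → l ≤ rear γ G t := by
      intro t ht
      refine le_csInf (ne_of_fin hG hl₀ ht) ?_
      rintro m ⟨hm, hm'⟩
      by_contra hlt
      push Not at hlt
      have := (df_anti γ G hlt.le).trans hm'
      rw [htop] at this
      simp at this
    have h1 : ENNReal.ofReal (conj φ l) * ∫⁻ t in II γ, ENNReal.ofReal (w t) ≤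
        rho γ (conj φ) w G := by
      rw [← lintegral_const_mul _ (hw.1.ennreal_ofReal)]
      refine lintegral_mono_ae ?_
      have hae0 : ∀ᵐ t ∂(volume.restrict (II γ)), t ∉ ({0} : Set ℝ) :=
        ae_restrict_of_ae (compl_mem_ae_iff.2 (by simp))
      filter_upwards [hae0, ae_restrict_mem (II_meas γ)] with t h2 h3
      have ht : 0 < t := lt_of_le_of_ne h3.1 (fun h => h2 h.symm)
      rw [← ENNReal.ofReal_mul (conj_nonneg hφ l)]
      exact ENNReal.ofReal_le_ofReal
        (mul_le_mul_of_nonneg_right (conj_mono hφ (hge t ht)) (hw.2.1 t h3).le)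
    rw [hw.2.2.2.2 hγ, ENNReal.mul_top (ENNReal.ofReal_pos.2 (conj_pos hφ hl)).ne', h] at h1
    simp at h1
  · push Not at hex
    have hz : ∀ t, rear γ G t = 0 := by
      intro t
      have : {l : ℝ | 0 < l ∧ df γ G l ≤ ENNReal.ofReal t} = ∅ := by
        ext m
        simp only [mem_setOf_eq, mem_empty_iff_false, iff_false, not_and]
        intro _ hm
        have := (hex m).trans hm
        simp at this
      simp [rear, this]
    simp [rho, hz, conj_zero hφ] at h

end conv

/-- if `ρ_{φ_*,w}(p(k|f|)) = 1` for some `k > 0`, then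
`‖f‖⁰ = ∫_I f^*(t) p(k f^*(t)) w(t) dt = (1/k)(1 + ρ_{φ,w}(kf))`. -/
theorem statement0 (γ : ℝ≥0∞) (hγ : 0 < γ) (w : ℝ → ℝ) (hw : IsWeight γ w)
    (φ p : ℝ → ℝ) (hφ : IsN φ) (hp : IsRightDeriv φ p)
    (f : ℝ → ℝ) (hf : MemL γ φ w f) (k : ℝ) (hk : 0 < k)
    (hmod : rho γ (conj φ) w (fun t => p (k * |f t|)) = 1) :
    orl γ φ w f = (∫⁻ t in II γ, ENNReal.ofReal (rear γ f t * p (k * rear γ f t) * w t)) ∧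
    orl γ φ w f = (ENNReal.ofReal k)⁻¹ * (1 + rho γ φ w (fun t => k * f t)) := by
  have hfm := hf.1
  set F : ℝ → ℝ := fun t => k * f t with hFdef
  have hFm : Measurable F := hfm.const_mul k
  have hGeq : (fun t => p (k * |f t|)) = fun t => p |F t| := by
    funext t; simp [hFdef, abs_mul, abs_of_pos hk]
  rw [hGeq] at hmod
  have hGm : Measurable fun t => p |F t| := meas_p_comp hφ hp hFm
  have hGin := fin_of_rho hφ hw hGm hmod
  have hFin : FinD γ F := by
    intro l hl
    have hpl := p_pos hφ hp hl
    refine lt_of_le_of_lt (measure_mono ?_) (hGin (p l / 2) (by positivity))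
    rintro s ⟨h1, h2⟩
    refine ⟨h1, ?_⟩
    have := p_mono hφ hp hl.le h2.le
    have := le_abs_self (p |F s|)
    linarith
  have hrear : ∀ t, rear γ F t = k * rear γ f t := fun t => rear_smul γ f hk t
  have hF0 : ∀ t, 0 ≤ rear γ F t := rear_nonneg γ F
  have hae := rear_p hφ hp hFm hFin hGin
  have hk0 : ENNReal.ofReal k ≠ 0 := (ENNReal.ofReal_pos.2 hk).ne'
  have hphim : AEMeasurable (fun t => ENNReal.ofReal (φ (rear γ F t) * w t))
      (volume.restrict (II γ)) :=
    ((meas_phi_comp hφ hp hF0 (aem_of_anti γ F).restrict).mul hw.1.aemeasurable).ennreal_ofReal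
  -- multiplication by `k`
  have hmulk : ∀ g : ℝ → ℝ,
      ENNReal.ofReal k * ∫⁻ t in II γ, ENNReal.ofReal (rear γ f t * g t * w t) =
        ∫⁻ t in II γ, ENNReal.ofReal (rear γ F t * g t * w t) := by
    intro g
    rw [← lintegral_const_mul' _ _ ENNReal.ofReal_ne_top]
    refine lintegral_congr fun t => ?_
    rw [← ENNReal.ofReal_mul hk.le, hrear]
    ring_nf
  have hsolve : ∀ a b : ℝ≥0∞, ENNReal.ofReal k * a = b → a = (ENNReal.ofReal k)⁻¹ * b := by
    rintro a b rfl
    rw [← mul_assoc, ENNReal.inv_mul_cancel hk0 ENNReal.ofReal_ne_top, one_mul]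
  have hB : (∫⁻ t in II γ, ENNReal.ofReal (rear γ f t * p (k * rear γ f t) * w t)) =
      (ENNReal.ofReal k)⁻¹ * (1 + rho γ φ w F) := by
    apply hsolve
    rw [hmulk fun t => p (k * rear γ f t), ← hmod, add_comm]
    unfold rho
    rw [← lintegral_add_left' hphim]
    refine lintegral_congr_ae ?_
    filter_upwards [hae, ae_restrict_mem (II_meas γ)] with t h1 h2
    have hwt := (hw.2.1 t h2).le
    rw [h1, ← hrear, young_eq hφ hp (hF0 t), add_mul, ENNReal.ofReal_add]
    · exact mul_nonneg (phi_nonneg hφ (hF0 t)) hwt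
    · exact mul_nonneg (conj_nonneg hφ _) hwt
  have hle : orl γ φ w f ≤ (ENNReal.ofReal k)⁻¹ * (1 + rho γ φ w F) := by
    refine iSup₂_le fun g hg => ?_
    rw [hsolve _ _ (hmulk (rear γ g))]
    refine mul_le_mul_right ?_ _
    refine le_trans ?_ (add_le_add_left hg.2 _)
    rw [add_comm]
    unfold rho
    rw [← lintegral_add_left' hphim]
    refine lintegral_mono_ae ?_
    filter_upwards [ae_restrict_mem (II_meas γ)] with t h2
    have hwt := (hw.2.1 t h2).le
    rw [← ENNReal.ofReal_add (mul_nonneg (phi_nonneg hφ (hF0 t)) hwt)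
      (mul_nonneg (conj_nonneg hφ _) hwt), ← add_mul]
    exact ENNReal.ofReal_le_ofReal (mul_le_mul_of_nonneg_right (young hφ (hF0 t) _) hwt)
  have hge : (∫⁻ t in II γ, ENNReal.ofReal (rear γ f t * p (k * rear γ f t) * w t)) ≤
      orl γ φ w f := by
    have h1 : (∫⁻ t in II γ, ENNReal.ofReal (rear γ f t * p (k * rear γ f t) * w t)) =
        ∫⁻ t in II γ, ENNReal.ofReal (rear γ f t * rear γ (fun t => p |F t|) t * w t) := by
      refine lintegral_congr_ae ?_
      filter_upwards [hae] with t h1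
      rw [h1, hrear]
    rw [h1]
    exact le_iSup₂_of_le (fun t => p |F t|) ⟨hGm, hmod.le⟩ le_rfl
  have h1 := le_antisymm (hle.trans hB.symm.le) hge
  exact ⟨h1, h1.trans hB⟩

end OL
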